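/- Let 𝒜 be a symmetric extended Z-tensor of order m and dimension n, and let 𝒜_h be the associated tensor of order 2m and dimension n, so that 𝒜_h x^{2m} = Σ_{i_1,…,i_m=1}^n a_{i_1⋯i_m} x_{i_1}^2 ⋯ x_{i_m}^2. Then 𝒜 is copositive if and only if there exists t ≤ 0 such that the polynomial t · Σ_{i=1}^n x_i^{2m} + 𝒜_h x^{2m} is a sums-of-squares polynomial; equivalently, min{ t ∈ ℝ : t · Σ_{i=1}^n x_i^{2m} + 𝒜_h x^{2m} is SOS } ≤ 0. -/

import Mathlib

open MvPolynomial Finset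

noncomputable section

/-- `tmul A x = 𝒜 x^m`, the homogeneous form associated with an
`m`-th order `n`-dimensional tensor `A`. -/
def tmul {m n : ℕ} (A : (Fin m → Fin n) → ℝ) (x : Fin n → ℝ) : ℝ :=
  ∑ g : Fin m → Fin n, A g * ∏ j, x (g j)

/-- A tensor is symmetric if its entries are invariant under permutations of the indices. -/
def IsSymT {m n : ℕ} (A : (Fin m → Fin n) → ℝ) : Prop :=
  ∀ (σ : Equiv.Perm (Fin m)) (g : Fin m → Fin n), A (g ∘ σ) = A g

/-- `lam` is an H-eigenvalue of a tensor of order `m + 1`: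
there is a nonzero `x` with `𝒜 x^m = lam * x^{[m]}`. -/
def IsHEig {m n : ℕ} (A : (Fin (m + 1) → Fin n) → ℝ) (lam : ℝ) : Prop :=
  ∃ x : Fin n → ℝ, x ≠ 0 ∧ ∀ i : Fin n,
    (∑ g : Fin m → Fin n, A (Fin.cons i g) * ∏ j, x (g j)) = lam * x i ^ m

/-- `𝒜_Γ x_Γ^m` for a subtensor `B` indexed by an index set `Γ ⊆ {1,…,n}`. -/
def subTmul {m n : ℕ} (Γ : Finset (Fin n)) (B : (Fin m → Γ) → ℝ) (x : Fin n → ℝ) : ℝ :=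
  ∑ g : Fin m → Γ, B g * ∏ j, x (g j).1

/-- An index tuple is off-diagonal if not all of its entries coincide. -/
def NotDiag {m : ℕ} {I : Type*} (g : Fin m → I) : Prop := ¬ ∀ j j' : Fin m, g j = g j'

/-- Condition (iii) in the definition of a W-tensor, for one subtensor. -/
def WCondIII {m n : ℕ} {Γ : Finset (Fin n)} (B : (Fin m → Γ) → ℝ) : Prop :=
  (∃ gb : Fin m → Γ, NotDiag gb ∧ ∀ g : Fin m → Γ, NotDiag g →
      (∀ σ : Equiv.Perm (Fin m), g ≠ gb ∘ σ) → B g = 0) ∨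
  (∀ g : Fin m → Γ, NotDiag g → 0 ≤ B g)

/-- Condition (i) in the definition of a W-tensor. -/
def WCondI {n s : ℕ} (Γ : Fin s → Finset (Fin n)) : Prop :=
  ∀ p : Fin s, 0 < (p : ℕ) →
    (((Finset.univ.filter fun l => l < p).biUnion Γ) ∩ Γ p).card ≤ 1

/-- W-tensor. -/
def IsWTensor {m n : ℕ} (A : (Fin m → Fin n) → ℝ) : Prop :=
  ∃ (s : ℕ) (Γ : Fin s → Finset (Fin n)) (B : ∀ l : Fin s, (Fin m → Γ l) → ℝ),
    0 < s ∧ s ≤ n ∧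
    Function.Injective Γ ∧
    Finset.univ.biUnion Γ = Finset.univ ∧
    WCondI Γ ∧
    (∀ x : Fin n → ℝ, tmul A x = ∑ l, subTmul (Γ l) (B l) x) ∧
    (∀ l, WCondIII (B l))

/-- Sums of squares of polynomials. -/
def IsSOSPoly {σ : Type*} (p : MvPolynomial σ ℝ) : Prop :=
  ∃ (r : ℕ) (q : Fin r → MvPolynomial σ ℝ), p = ∑ j, q j ^ 2

/-- The polynomial `𝒜 x^m` as a formal multivariate polynomial. -/
def tpoly {m n : ℕ} (A : (Fin m → Fin n) → ℝ) : MvPolynomial (Fin n) ℝ :=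
  ∑ g : Fin m → Fin n, MvPolynomial.C (A g) * ∏ j, MvPolynomial.X (g j)

/-- The polynomial `𝒜_Γ x_Γ^m` of a subtensor, in the variables `x_Γ`. -/
def subTpoly {m n : ℕ} (Γ : Finset (Fin n)) (B : (Fin m → Γ) → ℝ) : MvPolynomial Γ ℝ :=
  ∑ g : Fin m → Γ, MvPolynomial.C (B g) * ∏ j, MvPolynomial.X (g j)

/-- A (symmetric) tensor is copositive if `𝒜 x^m ≥ 0` for all entrywise-nonnegative `x`. -/
def Copositive {m n : ℕ} (A : (Fin m → Fin n) → ℝ) : Prop :=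
  ∀ x : Fin n → ℝ, (∀ i, 0 ≤ x i) → 0 ≤ tmul A x


/-- Extended Z-tensor: the associated polynomial `𝒜x^m` decomposes as
`∑ f_{m,i} x_i^m + ∑_l ∑_{α ∈ Ω_l} f_α x^α` over pairwise disjoint index sets
`Γ_1,…,Γ_s` covering `{1,…,n}`, where each mixed monomial lives in some `Γ_l`,
and for each `l` either only one mixed monomial has a nonzero coefficient, or all
mixed coefficients are nonpositive. -/
def IsExtZ {m n : ℕ} (A : (Fin m → Fin n) → ℝ) : Prop :=
  ∃ (s : ℕ) (Γ : Fin s → Finset (Fin n)),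
    s ≤ n ∧
    (∀ l₁ l₂, l₁ ≠ l₂ → Disjoint (Γ l₁) (Γ l₂)) ∧
    Finset.univ.biUnion Γ = Finset.univ ∧
    (∀ α : Fin n →₀ ℕ, MvPolynomial.coeff α (tpoly A) ≠ 0 →
      (∀ i : Fin n, α ≠ Finsupp.single i m) → ∃ l, α.support ⊆ Γ l) ∧
    (∀ l : Fin s,
      (∀ α β : Fin n →₀ ℕ,
        MvPolynomial.coeff α (tpoly A) ≠ 0 → (∀ i, α ≠ Finsupp.single i m) → α.support ⊆ Γ l →
        MvPolynomial.coeff β (tpoly A) ≠ 0 → (∀ i, β ≠ Finsupp.single i m) → β.support ⊆ Γ l →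
        α = β) ∨
      (∀ α : Fin n →₀ ℕ, (∀ i, α ≠ Finsupp.single i m) → α.support ⊆ Γ l →
        MvPolynomial.coeff α (tpoly A) ≤ 0))

theorem IsSumSq.algebraMap_mul {R : Type*} [CommRing R] [Algebra ℝ R] {c : ℝ} (hc : 0 ≤ c)
    {x : R} (hx : IsSumSq x) : IsSumSq (algebraMap ℝ R c * x) := by
  have h : algebraMap ℝ R c = algebraMap ℝ R √c * algebraMap ℝ R √c := by
    rw [← map_mul, Real.mul_self_sqrt hc]
  rw [h]
  exact (IsSumSq.mul_self _).mul hx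

theorem IsSumSq.pow {R : Type*} [CommRing R] {x : R} (hx : IsSumSq x) (k : ℕ) :
    IsSumSq (x ^ k) := by
  induction k with
  | zero => simp
  | succ k ih => rw [pow_succ]; exact ih.mul hx

theorem IsSumSq.sub_mul_pow_sub_pow {R : Type*} [CommRing R] {a b : R} (ha : IsSumSq a)
    (hb : IsSumSq b) (k : ℕ) : IsSumSq ((a - b) * (a ^ k - b ^ k)) := by
  rw [← geom_sum₂_mul a b k, mul_left_comm]
  exact (IsSumSq.sum fun i _ => (ha.pow _).mul (hb.pow _)).mul (IsSumSq.mul_self _)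

/-- The arithmetic-geometric mean inequality as a sum of squares identity. -/
theorem isSumSq_sum_pow_sub_mul_prod {R : Type*} [CommRing R] [Algebra ℝ R] (m : ℕ)
    (y : Fin m → R) (hy : ∀ j, IsSumSq (y j)) :
    IsSumSq (∑ j, y j ^ m - (m : R) * ∏ j, y j) := by
  induction m with
  | zero => simp
  | succ k ih =>
    rcases Nat.eq_zero_or_pos k with rfl | hk
    · simp
    have hsub : IsSumSq (∑ i, y i * (∑ j, y (i.succAbove j) ^ k -
        (k : R) * ∏ j, y (i.succAbove j))) :=
      IsSumSq.sum fun i _ => (hy i).mul (ih _ fun j => hy _)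
    have hdiff : IsSumSq (∑ i, ∑ j, (y i - y j) * (y i ^ k - y j ^ k)) :=
      IsSumSq.sum fun i _ => IsSumSq.sum fun j _ => (hy i).sub_mul_pow_sub_pow (hy j) k
    have hsub_eq : ∑ i, y i * (∑ j, y (i.succAbove j) ^ k - (k : R) * ∏ j, y (i.succAbove j)) =
        (∑ i, y i) * (∑ j, y j ^ k) - ∑ i, y i ^ (k + 1) -
          (k : R) * ((k + 1 : ℕ) : R) * ∏ j, y j := by
      have h : ∀ i, y i * (∑ j, y (i.succAbove j) ^ k - (k : R) * ∏ j, y (i.succAbove j)) =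
          y i * (∑ j, y j ^ k) - y i ^ (k + 1) - (k : R) * ∏ j, y j := by
        intro i
        rw [Fin.sum_univ_succAbove (fun j => y j ^ k) i, Fin.prod_univ_succAbove y i]
        ring
      simp only [h, Finset.sum_sub_distrib, Finset.sum_const, Finset.card_univ, Fintype.card_fin,
        nsmul_eq_mul, ← Finset.sum_mul]
      ring
    have hdiff_eq : ∑ i, ∑ j, (y i - y j) * (y i ^ k - y j ^ k) =
        2 * ((k + 1 : ℕ) : R) * ∑ i, y i ^ (k + 1) - 2 * ((∑ i, y i) * (∑ j, y j ^ k)) := by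
      have h : ∀ i j, (y i - y j) * (y i ^ k - y j ^ k) =
          y i ^ (k + 1) + y j ^ (k + 1) - y i * y j ^ k - y i ^ k * y j := by
        intro i j
        ring
      simp only [h, Finset.sum_sub_distrib, Finset.sum_add_distrib, Finset.sum_const,
        Finset.card_univ, Fintype.card_fin, nsmul_eq_mul, ← Finset.sum_mul, ← Finset.mul_sum]
      ring
    have hk' : (k : ℝ) ≠ 0 := by positivity
    have hinv : algebraMap ℝ R (k : ℝ)⁻¹ * (k : R) = 1 := by
      rw [← map_natCast (algebraMap ℝ R) k, ← map_mul, inv_mul_cancel₀ hk', map_one]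
    have hhalf : algebraMap ℝ R 2⁻¹ * 2 = 1 := by
      rw [← map_ofNat (algebraMap ℝ R) 2, ← map_mul]; norm_num
    have key := (hsub.add (hdiff.algebraMap_mul (by norm_num : (0 : ℝ) ≤ 2⁻¹))).algebraMap_mul
      (by positivity : (0 : ℝ) ≤ (k : ℝ)⁻¹)
    convert key using 1
    rw [hsub_eq, hdiff_eq]
    push_cast
    generalize (∑ i, y i) * (∑ j, y j ^ k) = U
    generalize ∑ i, y i ^ (k + 1) = V
    linear_combination ((k + 1 : R) * (∏ j, y j) - V) * hinv -
      algebraMap ℝ R (k : ℝ)⁻¹ * ((k + 1) * V - U) * hhalf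

/-- The weighted arithmetic-geometric mean inequality as a sum of squares identity. -/
theorem isSumSq_sum_weight_mul_pow_sub {σ R : Type*} [Fintype σ] [CommRing R]
    [Algebra ℝ R] {m : ℕ} (z : σ → R) (hz : ∀ i, IsSumSq (z i)) (α : σ → ℕ)
    (hα : ∑ i, α i = m) :
    IsSumSq (∑ i, (α i : R) * z i ^ m - (m : R) * ∏ i, z i ^ α i) := by
  let e : Fin m ≃ (i : σ) × Fin (α i) := (Fintype.equivFinOfCardEq (by simp [hα])).symm
  have h := isSumSq_sum_pow_sub_mul_prod m (fun j => z (e j).1) fun j => hz _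
  rw [e.sum_comp (fun p => z p.1 ^ m), e.prod_comp (fun p => z p.1), Fintype.sum_sigma,
    Fintype.prod_sigma] at h
  simpa using h

theorem exists_sub_nonneg_with_zero {σ : Type*} [Fintype σ] [DecidableEq σ] {m : ℕ} (hm : m ≠ 0)
    {Γ : Finset σ} (hΓ : Γ.Nonempty) {F : (σ → ℝ) → ℝ} (hcont : Continuous F)
    (hhom : ∀ (s : ℝ) (y : σ → ℝ), F (s • y) = s ^ m * F y)
    (hloc : ∀ y : σ → ℝ, F (fun i => if i ∈ Γ then y i else 0) = F y)
    (hF : ∀ y : σ → ℝ, 0 ≤ y → 0 ≤ F y) :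
    ∃ r : ℝ, 0 ≤ r ∧ (∀ y : σ → ℝ, 0 ≤ y → r * ∑ i ∈ Γ, y i ^ m ≤ F y) ∧
      ∃ y : σ → ℝ, 0 ≤ y ∧ (∃ i ∈ Γ, 0 < y i) ∧
        F y = r * ∑ i ∈ Γ, y i ^ m := by
  let K : Set (σ → ℝ) := stdSimplex ℝ σ ∩ {y | ∀ i, i ∉ Γ → y i = 0}
  have hKc : IsCompact K := by
    refine (isCompact_stdSimplex ℝ σ).inter_right ?_
    simp only [Set.ofPred_forall]
    exact isClosed_iInter fun i => isClosed_iInter fun _ =>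
      isClosed_eq (continuous_apply i) continuous_const
  obtain ⟨i₀, hi₀⟩ := hΓ
  have hKne : K.Nonempty := by
    refine ⟨Pi.single i₀ 1, single_mem_stdSimplex ℝ i₀, fun i hi => ?_⟩
    exact Pi.single_eq_of_ne (ne_of_mem_of_not_mem hi₀ hi).symm _
  have hex : ∀ y ∈ K, ∃ i ∈ Γ, 0 < y i := by
    rintro y ⟨⟨hy0, hy1⟩, hyΓ⟩
    by_contra! hcon
    have : ∑ i, y i = 0 := Finset.sum_eq_zero fun i _ => by
      by_cases hi : i ∈ Γ
      · exact le_antisymm (hcon i hi) (hy0 i)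
      · exact hyΓ i hi
    linarith
  have hpos : ∀ y : σ → ℝ, 0 ≤ y → (∃ i ∈ Γ, 0 < y i) → 0 < ∑ i ∈ Γ, y i ^ m :=
    fun y hy ⟨i, hi, hyi⟩ =>
      Finset.sum_pos' (fun j _ => pow_nonneg (hy j) m) ⟨i, hi, pow_pos hyi m⟩
  have hKpos : ∀ y ∈ K, 0 < ∑ i ∈ Γ, y i ^ m := fun y hy => hpos y hy.1.1 (hex y hy)
  obtain ⟨y, hyK, hymin⟩ := hKc.exists_isMinOn hKne
    (f := fun y => F y / ∑ i ∈ Γ, y i ^ m)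
    (hcont.continuousOn.div (by fun_prop) fun y hy => (hKpos y hy).ne')
  refine ⟨F y / ∑ i ∈ Γ, y i ^ m, div_nonneg (hF y hyK.1.1) (hKpos y hyK).le, ?_, y, hyK.1.1,
    hex y hyK, ?_⟩
  · intro x hx
    let x' : σ → ℝ := fun i => if i ∈ Γ then x i else 0
    have hx' : ∑ i, x' i = ∑ i ∈ Γ, x i := by simp [x']
    by_cases hx0 : ∃ i ∈ Γ, 0 < x i
    · have hs : 0 < ∑ i ∈ Γ, x i := by
        obtain ⟨i, hi, hxi⟩ := hx0
        exact Finset.sum_pos' (fun j _ => hx j) ⟨i, hi, hxi⟩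
      have hmem : (∑ i ∈ Γ, x i)⁻¹ • x' ∈ K := by
        refine ⟨⟨fun i => ?_, ?_⟩, fun i hi => ?_⟩
        · refine mul_nonneg (by positivity) ?_
          by_cases hi : i ∈ Γ
          · simpa [x', hi] using hx i
          · simp [x', hi]
        · simp only [Pi.smul_apply, smul_eq_mul, ← Finset.mul_sum, hx']
          exact inv_mul_cancel₀ hs.ne'
        · simp [x', hi]
      have hle := hymin hmem
      simp only [Set.mem_ofPred_eq, hhom, Pi.smul_apply, smul_eq_mul, mul_pow,
        ← Finset.mul_sum] at hle
      rw [mul_div_mul_left _ _ (by positivity)] at hle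
      have hxm : ∑ i ∈ Γ, x' i ^ m = ∑ i ∈ Γ, x i ^ m :=
        Finset.sum_congr rfl fun i hi => by simp [x', hi]
      rw [hxm, hloc x] at hle
      exact (le_div_iff₀ (hpos x hx hx0)).1 hle
    · push Not at hx0
      have : ∑ i ∈ Γ, x i ^ m = 0 := Finset.sum_eq_zero fun i hi => by
        simp [le_antisymm (hx0 i hi) (hx i), hm]
      rw [this, mul_zero]
      exact hF x hx
  · exact (div_mul_cancel₀ _ (hKpos y hyK).ne').symm

theorem mul_eq_sum_mul_of_nonneg_of_eq_zero {ι : Type*} {M : Finset ι} {w : ι → ℝ} {k : ι → ℕ}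
    {m : ℕ} {K a : ℝ} (hnn : ∀ t : ℝ, 0 ≤ t → 0 ≤ K + a * t ^ m - ∑ α ∈ M, w α * t ^ k α)
    (hzero : K + a - ∑ α ∈ M, w α = 0) : a * m = ∑ α ∈ M, w α * k α := by
  have hd : HasDerivAt (fun t : ℝ => K + a * t ^ m - ∑ α ∈ M, w α * t ^ k α)
      (a * (m * 1 ^ (m - 1)) - ∑ α ∈ M, w α * (k α * 1 ^ (k α - 1))) 1 := by
    refine (((hasDerivAt_pow m (1 : ℝ)).const_mul a).const_add K).sub ?_
    exact HasDerivAt.fun_sum fun α _ => (hasDerivAt_pow (k α) (1 : ℝ)).const_mul (w α)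
  have hmin : IsLocalMin (fun t : ℝ => K + a * t ^ m - ∑ α ∈ M, w α * t ^ k α) 1 := by
    filter_upwards [lt_mem_nhds (zero_lt_one (α := ℝ))] with t ht
    simpa [hzero] using hnn t ht.le
  have := hmin.hasDerivAt_eq_zero hd
  simp only [one_pow, mul_one] at this
  linarith

theorem nonpos_of_forall_mul_pow_le {b C : ℝ} {k m : ℕ} (hkm : k < m)
    (h : ∀ ε : ℝ, 0 < ε → b * ε ^ k ≤ C * ε ^ m) : b ≤ 0 := by
  have hle : ∀ᶠ ε in nhdsWithin (0 : ℝ) (Set.Ioi 0), b ≤ C * ε ^ (m - k) := by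
    filter_upwards [self_mem_nhdsWithin] with ε hε
    have := h ε hε
    rw [← Nat.sub_add_cancel hkm.le, pow_add, ← mul_assoc] at this
    exact le_of_mul_le_mul_right this (pow_pos hε k)
  have ht : Filter.Tendsto (fun ε : ℝ => C * ε ^ (m - k)) (nhdsWithin 0 (Set.Ioi 0)) (nhds 0) := by
    have hc : Continuous fun ε : ℝ => C * ε ^ (m - k) := by fun_prop
    simpa [Nat.sub_ne_zero_of_lt hkm] using (hc.tendsto 0).mono_left nhdsWithin_le_nhds
  exact ge_of_tendsto ht hle

theorem isSumSq_of_stationary {σ R : Type*} [Fintype σ] [DecidableEq σ] [CommRing R]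
    [Algebra ℝ R] {m : ℕ} (hm : m ≠ 0) {z : σ → R} (hz : ∀ i, IsSumSq (z i)) {S : Finset σ}
    {M : Finset (σ →₀ ℕ)} {c : σ → ℝ} {b : (σ →₀ ℕ) → ℝ}
    (hM : ∀ α ∈ M, ∑ i, α i = m ∧ α.support ⊆ S) (hb : ∀ α ∈ M, 0 ≤ b α)
    {y : σ → ℝ} (hy0 : 0 ≤ y) (hy : ∀ i ∈ S, 0 < y i)
    (hst : ∀ i ∈ S, c i * y i ^ m * m = ∑ α ∈ M, b α * (∏ j, y j ^ α j) * α i) :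
    IsSumSq (∑ i ∈ S, algebraMap ℝ R (c i) * z i ^ m -
      ∑ α ∈ M, algebraMap ℝ R (b α) * ∏ i, z i ^ α i) := by
  have hm' : (m : ℝ) ≠ 0 := Nat.cast_ne_zero.2 hm
  have hcoef : ∀ α ∈ M, 0 ≤ b α * (∏ j, y j ^ α j) / m := fun α hα =>
    div_nonneg (mul_nonneg (hb α hα) (Finset.prod_nonneg fun j _ => pow_nonneg (hy0 j) _))
      (Nat.cast_nonneg m)
  have key : IsSumSq (∑ α ∈ M, algebraMap ℝ R (b α * (∏ j, y j ^ α j) / m) *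
      (∑ i, (α i : R) * (algebraMap ℝ R (y i)⁻¹ * z i) ^ m -
        (m : R) * ∏ i, (algebraMap ℝ R (y i)⁻¹ * z i) ^ α i)) :=
    IsSumSq.sum fun α hα => (isSumSq_sum_weight_mul_pow_sub _
      (fun i => (hz i).algebraMap_mul (inv_nonneg.2 (hy0 i))) α (hM α hα).1).algebraMap_mul
        (hcoef α hα)
  convert key using 1
  simp only [mul_sub, Finset.sum_sub_distrib]
  congr 1
  · simp only [Finset.mul_sum]
    rw [Finset.sum_comm, ← Finset.sum_subset (Finset.subset_univ S)]
    · refine Finset.sum_congr rfl fun i hi => ?_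
      have hci : c i = ∑ α ∈ M, b α * (∏ j, y j ^ α j) / m * α i * (y i)⁻¹ ^ m := by
        have hyi : y i ^ m ≠ 0 := pow_ne_zero m (hy i hi).ne'
        rw [← Finset.sum_mul, inv_pow, eq_mul_inv_iff_mul_eq₀ hyi, ← mul_left_inj' hm', hst i hi,
          Finset.sum_mul]
        refine Finset.sum_congr rfl fun α _ => ?_
        field_simp
      rw [hci, map_sum, Finset.sum_mul]
      refine Finset.sum_congr rfl fun α _ => ?_
      rw [map_mul, map_mul, map_natCast, map_pow]
      ring
    · intro i _ hi
      refine Finset.sum_eq_zero fun α hα => ?_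
      have : α i = 0 := Finsupp.notMem_support_iff.1 fun h => hi ((hM α hα).2 h)
      simp [this]
  · refine Finset.sum_congr rfl fun α hα => ?_
    have hprod : b α = b α * (∏ j, y j ^ α j) / m * m * ∏ j, (y j)⁻¹ ^ α j := by
      have : (∏ j, y j ^ α j) * ∏ j, (y j)⁻¹ ^ α j = 1 := by
        rw [← Finset.prod_mul_distrib]
        refine Finset.prod_eq_one fun j _ => ?_
        by_cases hj : α j = 0
        · simp [hj]
        · rw [← mul_pow, mul_inv_cancel₀ (hy j ((hM α hα).2 (Finsupp.mem_support_iff.2 hj))).ne',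
            one_pow]
      rw [div_mul_cancel₀ _ hm', mul_assoc, this, mul_one]
    conv_lhs => rw [hprod]
    simp only [map_mul, map_natCast, map_prod, map_pow, mul_pow, Finset.prod_mul_distrib]
    ring

/-- A form `∑ c i * y i ^ m - ∑ b α * y ^ α` with `b ≥ 0` that is nonnegative on the nonnegative
orthant becomes a sum of squares when sums of squares are substituted for the variables. -/
theorem isSumSq_diag_sub_of_nonneg {σ R : Type*} [Fintype σ] [DecidableEq σ] [CommRing R]
    [Algebra ℝ R] {m : ℕ} (hm : m ≠ 0) {z : σ → R} (hz : ∀ i, IsSumSq (z i)) (Γ : Finset σ) :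
    ∀ (M : Finset (σ →₀ ℕ)) (c : σ → ℝ) (b : (σ →₀ ℕ) → ℝ),
      (∀ α ∈ M, ∑ i, α i = m ∧ α.support ⊆ Γ) → (∀ α ∈ M, 0 ≤ b α) →
      (∀ y : σ → ℝ, 0 ≤ y →
        0 ≤ ∑ i ∈ Γ, c i * y i ^ m - ∑ α ∈ M, b α * ∏ i, y i ^ α i) →
      IsSumSq (∑ i ∈ Γ, algebraMap ℝ R (c i) * z i ^ m -
        ∑ α ∈ M, algebraMap ℝ R (b α) * ∏ i, z i ^ α i) := by
  induction Γ using Finset.strongInduction with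
  | H Γ ih =>
  intro M c b hM hb hF
  rcases Γ.eq_empty_or_nonempty with rfl | hΓ
  · have : M = ∅ := by
      refine Finset.eq_empty_of_forall_notMem fun α hα => hm ?_
      obtain ⟨h1, h2⟩ := hM α hα
      rw [Finset.subset_empty, Finsupp.support_eq_empty] at h2
      simpa [h2] using h1.symm
    simp [this]
  obtain ⟨r, hr, hrF, y, hy0, hypos, hyF⟩ := exists_sub_nonneg_with_zero hm hΓ
    (F := fun y => ∑ i ∈ Γ, c i * y i ^ m - ∑ α ∈ M, b α * ∏ i, y i ^ α i) (by fun_prop)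
    (by
      intro s y
      simp only [Pi.smul_apply, smul_eq_mul, mul_pow, Finset.prod_mul_distrib, mul_sub,
        Finset.mul_sum]
      congr 1
      · exact Finset.sum_congr rfl fun i _ => by ring
      · refine Finset.sum_congr rfl fun α hα => ?_
        rw [Finset.prod_pow_eq_pow_sum, (hM α hα).1]
        ring)
    (by
      intro y
      congr 1
      · exact Finset.sum_congr rfl fun i hi => by simp [hi]
      · refine Finset.sum_congr rfl fun α hα => ?_
        congr 1
        refine Finset.prod_congr rfl fun i _ => ?_
        by_cases hi : i ∈ Γ
        · simp [hi]
        · have : α i = 0 := Finsupp.notMem_support_iff.1 fun h => hi ((hM α hα).2 h)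
          simp [this])
    hF
  have hG : ∀ x : σ → ℝ, 0 ≤ x →
      0 ≤ ∑ i ∈ Γ, (c i - r) * x i ^ m - ∑ α ∈ M, b α * ∏ i, x i ^ α i := by
    intro x hx
    have := hrF x hx
    simp only [sub_mul, Finset.sum_sub_distrib, ← Finset.mul_sum]
    linarith
  have hGy : ∑ i ∈ Γ, (c i - r) * y i ^ m - ∑ α ∈ M, b α * ∏ i, y i ^ α i = 0 := by
    simp only [sub_mul, Finset.sum_sub_distrib, ← Finset.mul_sum]
    linarith
  clear hF hrF hyF
  let S := Γ.filter fun i => 0 < y i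
  let T := Γ.filter fun i => ¬ 0 < y i
  have hyT : ∀ i, ¬ 0 < y i → y i = 0 := fun i h => le_antisymm (not_lt.1 h) (hy0 i)
  have hTΓ : T ⊂ Γ := by
    obtain ⟨i, hi, hyi⟩ := hypos
    exact Finset.filter_ssubset.2 ⟨i, hi, by simpa using hyi⟩
  have hvanish : ∀ α : σ →₀ ℕ, ∀ x : σ → ℝ, (∃ i ∈ α.support, x i = 0) →
      ∏ i, x i ^ α i = 0 := fun α x ⟨i, hi, hxi⟩ =>
    Finset.prod_eq_zero (Finset.mem_univ i) (by rw [hxi, zero_pow (Finsupp.mem_support_iff.1 hi)])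
  have hstat : ∀ i ∈ Γ, (c i - r) * y i ^ m * m =
      ∑ α ∈ M, b α * (∏ j, y j ^ α j) * α i := by
    intro i hi
    refine mul_eq_sum_mul_of_nonneg_of_eq_zero (K := ∑ j ∈ Γ.erase i, (c j - r) * y j ^ m)
      (fun t ht => ?_) ?_
    · have h := hG (fun j => if j = i then t * y j else y j) (fun j => by
        by_cases hj : j = i
        · simpa [hj] using mul_nonneg ht (hy0 i)
        · simpa [hj] using hy0 j)
      rw [← Finset.sum_erase_add _ _ hi] at h
      refine h.trans_eq ?_
      congr 1
      · congr 1
        · refine Finset.sum_congr rfl fun j hj => ?_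
          rw [if_neg (Finset.ne_of_mem_erase hj)]
        · simp only [if_true]
          ring
      · refine Finset.sum_congr rfl fun α _ => ?_
        rw [← Finset.mul_prod_erase _ _ (Finset.mem_univ i),
          ← Finset.mul_prod_erase _ (fun j => y j ^ α j) (Finset.mem_univ i), if_pos rfl,
          Finset.prod_congr rfl fun j hj => by rw [if_neg (Finset.ne_of_mem_erase hj)]]
        ring
    · rw [Finset.sum_erase_add _ _ hi]
      exact hGy
  have hcross : ∀ α ∈ M, ¬ α.support ⊆ S → ¬ α.support ⊆ T → b α = 0 := by
    intro α hα hS hT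
    obtain ⟨i, hiα, hiS⟩ := Finset.not_subset.1 hS
    obtain ⟨j, hjα, hjT⟩ := Finset.not_subset.1 hT
    have hyi : ¬ 0 < y i := fun h => hiS (Finset.mem_filter.2 ⟨(hM α hα).2 hiα, h⟩)
    have hyj : 0 < y j := by
      by_contra h
      exact hjT (Finset.mem_filter.2 ⟨(hM α hα).2 hjα, h⟩)
    refine le_antisymm ?_ (hb α hα)
    let P := ∏ l, if 0 < y l then y l ^ α l else 1
    have hP : 0 < P := Finset.prod_pos fun l _ => by
      split_ifs with h
      · exact pow_pos h _
      · exact one_pos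
    let k := ∑ l, if 0 < y l then 0 else α l
    have hk : k < m := by
      rw [← (hM α hα).1]
      refine Finset.sum_lt_sum (fun l _ => by split_ifs <;> simp) ⟨j, Finset.mem_univ j, ?_⟩
      rw [if_pos hyj]
      exact Nat.pos_of_ne_zero (Finsupp.mem_support_iff.1 hjα)
    refine nonpos_of_mul_nonpos_left (nonpos_of_forall_mul_pow_le (b := b α * P)
      (C := ∑ l ∈ T, (c l - r)) hk fun ε hε => ?_) hP
    let x : σ → ℝ := fun l => if 0 < y l then y l else ε
    have hx0 : 0 ≤ x := fun l => by
      simp only [x]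
      split_ifs with h
      · exact h.le
      · exact hε.le
    have hyx : ∀ l, y l ≤ x l := fun l => by
      simp only [x]
      split_ifs with h
      · exact le_rfl
      · exact (not_lt.1 h).trans hε.le
    have hprod : ∏ l, x l ^ α l = P * ε ^ k := by
      simp only [P, k, ← Finset.prod_pow_eq_pow_sum, ← Finset.prod_mul_distrib, x]
      refine Finset.prod_congr rfl fun l _ => ?_
      split_ifs <;> simp
    have hdiag : ∑ l ∈ Γ, (c l - r) * x l ^ m =
        ∑ l ∈ Γ, (c l - r) * y l ^ m + (∑ l ∈ T, (c l - r)) * ε ^ m := by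
      rw [Finset.sum_mul, Finset.sum_filter, ← Finset.sum_add_distrib]
      refine Finset.sum_congr rfl fun l _ => ?_
      by_cases h : 0 < y l
      · simp [x, h]
      · simp [x, hyT l h, hm]
    have hterm : b α * (P * ε ^ k) ≤
        ∑ β ∈ M, (b β * ∏ l, x l ^ β l - b β * ∏ l, y l ^ β l) := by
      have h := Finset.single_le_sum
        (f := fun β : σ →₀ ℕ => b β * ∏ l, x l ^ β l - b β * ∏ l, y l ^ β l)
        (fun β hβ => sub_nonneg.2 (mul_le_mul_of_nonneg_left
          (Finset.prod_le_prod (fun l _ => pow_nonneg (hy0 l) _)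
            fun l _ => pow_le_pow_left₀ (hy0 l) (hyx l) _) (hb β hβ))) hα
      simpa only [hprod, hvanish α y ⟨i, hiα, hyT i hyi⟩, mul_zero, sub_zero] using h
    have h := hG x hx0
    rw [hdiag] at h
    rw [Finset.sum_sub_distrib] at hterm
    linarith
  have hsplit : ∀ f : (σ →₀ ℕ) → R, ∑ α ∈ M, algebraMap ℝ R (b α) * f α =
      ∑ α ∈ M with α.support ⊆ S, algebraMap ℝ R (b α) * f α +
        ∑ α ∈ M with α.support ⊆ T, algebraMap ℝ R (b α) * f α := by
    intro f
    rw [← Finset.sum_filter_add_sum_filter_not M (fun α => α.support ⊆ S)]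
    congr 1
    refine (Finset.sum_subset (fun α hα => ?_) fun α hα hα' => ?_).symm
    · obtain ⟨hαM, hαT⟩ := Finset.mem_filter.1 hα
      refine Finset.mem_filter.2 ⟨hαM, fun hαS => hm ?_⟩
      have h0 : α.support = ∅ := Finset.disjoint_self_iff_empty _ |>.1
        ((Finset.disjoint_filter_filter_not Γ Γ fun i => 0 < y i).mono hαS hαT)
      rw [Finsupp.support_eq_empty] at h0
      simpa [h0] using (hM α hαM).1.symm
    · obtain ⟨hαM, hαS⟩ := Finset.mem_filter.1 hα
      rw [hcross α hαM hαS fun h => hα' (Finset.mem_filter.2 ⟨hαM, h⟩), map_zero, zero_mul]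
  have hSOS : IsSumSq (∑ i ∈ S, algebraMap ℝ R (c i - r) * z i ^ m -
      ∑ α ∈ M with α.support ⊆ S, algebraMap ℝ R (b α) * ∏ i, z i ^ α i) := by
    refine isSumSq_of_stationary hm hz
      (fun α hα => ⟨(hM α (Finset.mem_filter.1 hα).1).1, (Finset.mem_filter.1 hα).2⟩)
      (fun α hα => hb α (Finset.mem_filter.1 hα).1) hy0
      (fun i hi => (Finset.mem_filter.1 hi).2) fun i hi => ?_
    rw [hstat i (Finset.mem_filter.1 hi).1]
    refine (Finset.sum_subset (Finset.filter_subset _ M) fun α hα hα' => ?_).symm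
    obtain ⟨j, hj, hjS⟩ := Finset.not_subset.1 fun h => hα' (Finset.mem_filter.2 ⟨hα, h⟩)
    rw [hvanish α y ⟨j, hj, hyT j fun h => hjS (Finset.mem_filter.2 ⟨(hM α hα).2 hj, h⟩)⟩]
    simp
  have hTOS : IsSumSq (∑ i ∈ T, algebraMap ℝ R (c i - r) * z i ^ m -
      ∑ α ∈ M with α.support ⊆ T, algebraMap ℝ R (b α) * ∏ i, z i ^ α i) := by
    refine ih T hTΓ _ (fun i => c i - r) b
      (fun α hα => ⟨(hM α (Finset.mem_filter.1 hα).1).1, (Finset.mem_filter.1 hα).2⟩)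
      (fun α hα => hb α (Finset.mem_filter.1 hα).1) fun x hx => ?_
    have h := hG (fun i => if i ∈ T then x i else 0) (fun i => by
      by_cases hi : i ∈ T
      · simpa [hi] using hx i
      · simp [hi])
    refine h.trans_eq ?_
    congr 1
    · refine (Finset.sum_subset_zero_on_sdiff hTΓ.1 (fun i hi => ?_) fun i hi => ?_).symm
      · simp [(Finset.mem_sdiff.1 hi).2, hm]
      · simp [hi]
    · refine (Finset.sum_subset_zero_on_sdiff (Finset.filter_subset _ M) (fun α hα => ?_)
        fun α hα => ?_).symm
      · obtain ⟨hαM, hα'⟩ := Finset.mem_sdiff.1 hα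
        obtain ⟨j, hj, hjT⟩ := Finset.not_subset.1 fun h =>
          hα' (Finset.mem_filter.2 ⟨hαM, h⟩)
        rw [hvanish α _ ⟨j, hj, if_neg hjT⟩, mul_zero]
      · congr 1
        refine Finset.prod_congr rfl fun i _ => ?_
        by_cases hi : i ∈ T
        · simp [hi]
        · have : α i = 0 := Finsupp.notMem_support_iff.1 fun h =>
            hi ((Finset.mem_filter.1 hα).2 h)
          simp [this]
  have hrest : IsSumSq (∑ i ∈ Γ, algebraMap ℝ R r * z i ^ m) :=
    IsSumSq.sum fun i _ => ((hz i).pow m).algebraMap_mul hr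
  have hdiag : ∑ i ∈ Γ, algebraMap ℝ R (c i) * z i ^ m =
      (∑ i ∈ S, algebraMap ℝ R (c i - r) * z i ^ m +
        ∑ i ∈ T, algebraMap ℝ R (c i - r) * z i ^ m) +
        ∑ i ∈ Γ, algebraMap ℝ R r * z i ^ m := by
    rw [Finset.sum_filter_add_sum_filter_not, ← Finset.sum_add_distrib]
    refine Finset.sum_congr rfl fun i _ => ?_
    rw [map_sub]
    ring
  have hring : ∀ u v w p q : R, u + v + w - (p + q) = u - p + (v - q) + w := by
    intros
    ring
  rw [hsplit, hdiag, hring]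
  exact (hSOS.add hTOS).add hrest

theorem Finset.sum_eq_sum_of_pairwise_disjoint_cover {ι κ N : Type*} [Fintype ι] [DecidableEq κ]
    [AddCommMonoid N] {t : ι → Finset κ} {s : Finset κ} (f : κ → N)
    (hd : ∀ l₁ l₂, l₁ ≠ l₂ → Disjoint (t l₁) (t l₂)) (hs : Finset.univ.biUnion t = s) :
    ∑ a ∈ s, f a = ∑ l, ∑ a ∈ t l, f a := by
  rw [← hs]
  exact Finset.sum_biUnion fun a _ b _ hab => hd a b hab

theorem IsSumSq.isSOSPoly {σ : Type*} {p : MvPolynomial σ ℝ} (hp : IsSumSq p) : IsSOSPoly p := by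
  induction hp with
  | zero => exact ⟨0, Fin.elim0, by simp⟩
  | sq_add a _ ih =>
    obtain ⟨r, q, rfl⟩ := ih
    exact ⟨r + 1, Fin.cons a q, by simp [Fin.sum_univ_succ, sq]⟩

theorem IsSOSPoly.eval_nonneg {σ : Type*} {p : MvPolynomial σ ℝ} (hp : IsSOSPoly p)
    (x : σ → ℝ) : 0 ≤ eval x p := by
  obtain ⟨r, q, rfl⟩ := hp
  simp only [map_sum, map_pow]
  exact Finset.sum_nonneg fun j _ => sq_nonneg _

theorem eval_tpoly {m n : ℕ} (A : (Fin m → Fin n) → ℝ) (x : Fin n → ℝ) :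
    eval x (tpoly A) = tmul A x := by
  simp [tpoly, tmul, map_sum, map_prod]

theorem isHomogeneous_tpoly {m n : ℕ} (A : (Fin m → Fin n) → ℝ) : (tpoly A).IsHomogeneous m := by
  refine IsHomogeneous.sum _ _ _ fun g _ => ?_
  have h : (∏ j, (X (g j) : MvPolynomial (Fin n) ℝ)).IsHomogeneous (∑ _j : Fin m, 1) :=
    IsHomogeneous.prod _ _ _ fun j _ => isHomogeneous_X _ _
  simpa using (isHomogeneous_C (Fin n) (A g)).mul h

theorem sum_eq_of_mem_support_tpoly {m n : ℕ} {A : (Fin m → Fin n) → ℝ} {α : Fin n →₀ ℕ}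
    (hα : α ∈ (tpoly A).support) : ∑ i, α i = m := by
  rw [← Finsupp.degree_eq_sum, Finsupp.degree_apply]
  exact ((isHomogeneous_tpoly A).degree_eq_sum_deg_support hα).symm

/-- The exponents of the mixed monomials of `tpoly A` in the variables of `Γ`. -/
def mixedSupport {m n : ℕ} (A : (Fin m → Fin n) → ℝ) (Γ : Finset (Fin n)) :
    Finset (Fin n →₀ ℕ) :=
  (tpoly A).support.filter fun α => (∀ i, α ≠ Finsupp.single i m) ∧ α.support ⊆ Γ

theorem mem_mixedSupport {m n : ℕ} {A : (Fin m → Fin n) → ℝ} {Γ : Finset (Fin n)}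
    {α : Fin n →₀ ℕ} : α ∈ mixedSupport A Γ ↔
      coeff α (tpoly A) ≠ 0 ∧ (∀ i, α ≠ Finsupp.single i m) ∧ α.support ⊆ Γ := by
  rw [mixedSupport, Finset.mem_filter, mem_support_iff]

/-- The value at `z` of the part of `tpoly A` in the variables of `Γ`. -/
def blockAeval {m n : ℕ} {R : Type*} [CommRing R] [Algebra ℝ R] (A : (Fin m → Fin n) → ℝ)
    (Γ : Finset (Fin n)) (z : Fin n → R) : R :=
  ∑ i ∈ Γ, algebraMap ℝ R (coeff (Finsupp.single i m) (tpoly A)) * z i ^ m +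
    ∑ α ∈ mixedSupport A Γ, algebraMap ℝ R (coeff α (tpoly A)) * ∏ i, z i ^ α i

theorem sum_eq_of_mem_mixedSupport {m n : ℕ} {A : (Fin m → Fin n) → ℝ} {Γ : Finset (Fin n)}
    {α : Fin n →₀ ℕ} (hα : α ∈ mixedSupport A Γ) : ∑ i, α i = m :=
  sum_eq_of_mem_support_tpoly (Finset.mem_filter.1 hα).1

theorem aeval_tpoly_eq_blockAeval_univ {m n : ℕ} (hm : m ≠ 0) {R : Type*} [CommRing R]
    [Algebra ℝ R] (A : (Fin m → Fin n) → ℝ) (z : Fin n → R) :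
    aeval z (tpoly A) = blockAeval A Finset.univ z := by
  rw [aeval_def, eval₂_eq', blockAeval,
    ← Finset.sum_filter_not_add_sum_filter (tpoly A).support
      fun α => (∀ i, α ≠ Finsupp.single i m) ∧ α.support ⊆ Finset.univ]
  congr 1
  have hinj : Set.InjOn (fun i : Fin n => Finsupp.single i m) (Finset.univ : Finset (Fin n)) :=
    fun i _ j _ h => Finsupp.single_left_injective hm h
  have himage := Finset.sum_image (f := fun α : Fin n →₀ ℕ =>
    algebraMap ℝ R (coeff α (tpoly A)) * ∏ i, z i ^ α i) hinj
  trans ∑ α ∈ Finset.univ.image fun i : Fin n => Finsupp.single i m,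
    algebraMap ℝ R (coeff α (tpoly A)) * ∏ i, z i ^ α i
  · refine Finset.sum_subset (fun α hα => ?_) fun α hα hα' => ?_
    · have h := (Finset.mem_filter.1 hα).2
      simp only [Finset.subset_univ, and_true, not_forall, not_not] at h
      obtain ⟨i, rfl⟩ := h
      exact Finset.mem_image_of_mem _ (Finset.mem_univ i)
    · obtain ⟨i, -, rfl⟩ := Finset.mem_image.1 hα
      have h : coeff (Finsupp.single i m) (tpoly A) = 0 := by
        by_contra h
        exact hα' (Finset.mem_filter.2 ⟨mem_support_iff.2 h, fun h' => h'.1 i rfl⟩)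
      rw [h, map_zero, zero_mul]
  · rw [himage]
    refine Finset.sum_congr rfl fun i _ => ?_
    rw [Finset.prod_eq_single i (fun j _ hj => by simp [hj]) (by simp),
      Finsupp.single_eq_same]

theorem aeval_tpoly_eq_sum_blockAeval {m n s : ℕ} (hm : m ≠ 0) {R : Type*} [CommRing R]
    [Algebra ℝ R] (A : (Fin m → Fin n) → ℝ) {Γ : Fin s → Finset (Fin n)}
    (hd : ∀ l₁ l₂, l₁ ≠ l₂ → Disjoint (Γ l₁) (Γ l₂))
    (hcover : Finset.univ.biUnion Γ = Finset.univ)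
    (hmix : ∀ α : Fin n →₀ ℕ, coeff α (tpoly A) ≠ 0 →
      (∀ i : Fin n, α ≠ Finsupp.single i m) → ∃ l, α.support ⊆ Γ l) (z : Fin n → R) :
    aeval z (tpoly A) = ∑ l, blockAeval A (Γ l) z := by
  simp only [aeval_tpoly_eq_blockAeval_univ hm, blockAeval, Finset.sum_add_distrib]
  congr 1
  · exact Finset.sum_eq_sum_of_pairwise_disjoint_cover _ hd hcover
  · refine Finset.sum_eq_sum_of_pairwise_disjoint_cover _ (fun l₁ l₂ hl => ?_) ?_
    · refine Finset.disjoint_left.2 fun α h₁ h₂ => hm ?_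
      have h0 : α.support = ∅ := (Finset.disjoint_self_iff_empty _).1
        ((hd l₁ l₂ hl).mono (mem_mixedSupport.1 h₁).2.2 (mem_mixedSupport.1 h₂).2.2)
      rw [Finsupp.support_eq_empty] at h0
      simpa [h0] using (sum_eq_of_mem_mixedSupport h₁).symm
    · ext α
      simp only [Finset.mem_biUnion, Finset.mem_univ, true_and, mem_mixedSupport,
        Finset.subset_univ, and_true]
      exact ⟨fun ⟨_, h₁, h₂, _⟩ => ⟨h₁, h₂⟩,
        fun ⟨h₁, h₂⟩ => (hmix α h₁ h₂).imp fun _ h₃ => ⟨h₁, h₂, h₃⟩⟩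

theorem Copositive.blockAeval_nonneg {m n : ℕ} (hm : m ≠ 0) {A : (Fin m → Fin n) → ℝ}
    (hA : Copositive A) (Γ : Finset (Fin n)) {y : Fin n → ℝ} (hy : 0 ≤ y) :
    0 ≤ blockAeval A Γ y := by
  have h := hA (fun i => if i ∈ Γ then y i else 0) fun i => by
    by_cases hi : i ∈ Γ
    · simpa [hi] using hy i
    · simp [hi]
  rw [← eval_tpoly, ← coe_aeval_eq_eval, RingHom.coe_coe, aeval_tpoly_eq_blockAeval_univ hm] at h
  refine h.trans_eq ?_
  rw [blockAeval, blockAeval]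
  congr 1
  · refine Finset.sum_subset_zero_on_sdiff (Finset.subset_univ Γ) (fun i hi => ?_) (fun i hi => ?_)
      |>.symm
    · simp [(Finset.mem_sdiff.1 hi).2, hm]
    · simp [hi]
  · refine Finset.sum_subset_zero_on_sdiff (fun α hα => ?_) (fun α hα => ?_) (fun α hα => ?_)
      |>.symm
    · obtain ⟨h₁, h₂, -⟩ := mem_mixedSupport.1 hα
      exact mem_mixedSupport.2 ⟨h₁, h₂, Finset.subset_univ _⟩
    · obtain ⟨hα₁, hα₂⟩ := Finset.mem_sdiff.1 hα
      obtain ⟨h₁, h₂, -⟩ := mem_mixedSupport.1 hα₁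
      obtain ⟨j, hj, hjΓ⟩ := Finset.not_subset.1 fun h =>
        hα₂ (mem_mixedSupport.2 ⟨h₁, h₂, h⟩)
      rw [Finset.prod_eq_zero (Finset.mem_univ j), mul_zero]
      simp [hjΓ, Finsupp.mem_support_iff.1 hj]
    · congr 1
      refine Finset.prod_congr rfl fun i _ => ?_
      by_cases hi : i ∈ Γ
      · simp [hi]
      · have : α i = 0 := Finsupp.notMem_support_iff.1 fun h =>
          hi ((mem_mixedSupport.1 hα).2.2 h)
        simp [this]

theorem Copositive.coeff_single_nonneg {m n : ℕ} (hm : m ≠ 0) {A : (Fin m → Fin n) → ℝ}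
    (hA : Copositive A) (i : Fin n) : 0 ≤ coeff (Finsupp.single i m) (tpoly A) := by
  have h := hA.blockAeval_nonneg hm {i} (y := fun _ => 1) fun _ => zero_le_one
  have hempty : mixedSupport A {i} = ∅ := by
    refine Finset.eq_empty_of_forall_notMem fun α hα => ?_
    obtain ⟨-, h₂, h₃⟩ := mem_mixedSupport.1 hα
    obtain ⟨k, rfl⟩ := Finsupp.support_subset_singleton'.1 h₃
    refine h₂ i ?_
    have hk := sum_eq_of_mem_mixedSupport hα
    rw [Finset.sum_eq_single i (fun j _ hj => by simp [hj]) (by simp),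
      Finsupp.single_eq_same] at hk
    rw [hk]
  simpa [blockAeval, hempty] using h

theorem Copositive.isSumSq_blockAeval {m n : ℕ} (hm : m ≠ 0) {A : (Fin m → Fin n) → ℝ}
    (hA : Copositive A) {Γ : Finset (Fin n)}
    (hΓ : (∀ α ∈ mixedSupport A Γ, 0 ≤ coeff α (tpoly A)) ∨
      ∀ α ∈ mixedSupport A Γ, coeff α (tpoly A) ≤ 0)
    {R : Type*} [CommRing R] [Algebra ℝ R] {z : Fin n → R} (hz : ∀ i, IsSumSq (z i)) :
    IsSumSq (blockAeval A Γ z) := by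
  rcases hΓ with h | h
  · exact (IsSumSq.sum fun i _ =>
      ((hz i).pow m).algebraMap_mul (hA.coeff_single_nonneg hm i)).add
      (IsSumSq.sum fun α hα =>
        (IsSumSq.prod fun i _ => (hz i).pow (α i)).algebraMap_mul (h α hα))
  · have key := isSumSq_diag_sub_of_nonneg hm hz Γ (mixedSupport A Γ)
      (fun i => coeff (Finsupp.single i m) (tpoly A)) (fun α => -coeff α (tpoly A))
      (fun α hα => ⟨sum_eq_of_mem_mixedSupport hα, (mem_mixedSupport.1 hα).2.2⟩)
      (fun α hα => neg_nonneg.2 (h α hα)) fun y hy => by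
        simpa [blockAeval] using hA.blockAeval_nonneg hm Γ hy
    simpa [blockAeval] using key

theorem Copositive.isSumSq_aeval {m n : ℕ} {A : (Fin m → Fin n) → ℝ} (hA : Copositive A)
    (hZ : IsExtZ A) {R : Type*} [CommRing R] [Algebra ℝ R] {z : Fin n → R}
    (hz : ∀ i, IsSumSq (z i)) : IsSumSq (aeval z (tpoly A)) := by
  rcases eq_or_ne m 0 with rfl | hm
  · have h := hA 0 fun _ => le_rfl
    rw [tmul] at h
    simp only [Finset.univ_eq_empty, Finset.prod_empty, mul_one] at h
    simpa [tpoly] using IsSumSq.one.algebraMap_mul (R := R) h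
  obtain ⟨s, Γ, -, hd, hcover, hmix, hsign⟩ := hZ
  rw [aeval_tpoly_eq_sum_blockAeval hm A hd hcover hmix]
  refine IsSumSq.sum fun l _ => hA.isSumSq_blockAeval hm ?_ hz
  rcases hsign l with h | h
  · rw [or_iff_not_imp_left]
    intro hneg
    push Not at hneg
    obtain ⟨β, hβ, hβneg⟩ := hneg
    intro α hα
    obtain ⟨hα₁, hα₂, hα₃⟩ := mem_mixedSupport.1 hα
    obtain ⟨hβ₁, hβ₂, hβ₃⟩ := mem_mixedSupport.1 hβ
    rw [h α β hα₁ hα₂ hα₃ hβ₁ hβ₂ hβ₃]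
    exact hβneg.le
  · exact Or.inr fun α hα => h α (mem_mixedSupport.1 hα).2.1 (mem_mixedSupport.1 hα).2.2

theorem tpoly_eq_aeval_X_sq {m n : ℕ} {A : (Fin m → Fin n) → ℝ}
    {Ah : (Fin (2 * m) → Fin n) → ℝ}
    (hAh : ∀ x : Fin n → ℝ, tmul Ah x = ∑ g : Fin m → Fin n, A g * ∏ j, (x (g j)) ^ 2) :
    tpoly Ah = aeval (fun i => (X i : MvPolynomial (Fin n) ℝ) ^ 2) (tpoly A) := by
  refine MvPolynomial.funext fun x => ?_
  rw [eval_tpoly, hAh]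
  simp [tpoly, map_sum, map_prod]

/-- Corollary 5.1: a symmetric extended Z-tensor `𝒜` (of odd or even order `m`) is
copositive iff there is some `t ≤ 0` such that `t ∑ x_i^{2m} + 𝒜_h x^{2m}` is SOS,
where `𝒜_h x^{2m} = ∑ a_{i₁⋯i_m} x_{i₁}² ⋯ x_{i_m}²`. -/
theorem corollary51 (m n : ℕ)
    (A : (Fin m → Fin n) → ℝ) (hsym : IsSymT A) (hZ : IsExtZ A)
    (Ah : (Fin (2 * m) → Fin n) → ℝ) (hAhsym : IsSymT Ah)
    (hAh : ∀ x : Fin n → ℝ, tmul Ah x = ∑ g : Fin m → Fin n, A g * ∏ j, (x (g j)) ^ 2) :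
    Copositive A ↔ ∃ t : ℝ, t ≤ 0 ∧
      IsSOSPoly (MvPolynomial.C t * (∑ i, MvPolynomial.X i ^ (2 * m)) + tpoly Ah) := by
  constructor
  · intro hA
    refine ⟨0, le_rfl, ?_⟩
    rw [C_0, zero_mul, zero_add, tpoly_eq_aeval_X_sq hAh]
    exact (hA.isSumSq_aeval hZ fun i => (IsSquare.sq _).isSumSq).isSOSPoly
  · rintro ⟨t, ht, hsos⟩ x hx
    have h := hsos.eval_nonneg fun i => √(x i)
    have hsq : ∀ i, √(x i) ^ 2 = x i := fun i => Real.sq_sqrt (hx i)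
    simp only [map_add, map_mul, eval_C, map_sum, map_pow, eval_X, eval_tpoly, hAh, pow_mul,
      hsq] at h
    have hdiag : 0 ≤ ∑ i, x i ^ m := Finset.sum_nonneg fun i _ => pow_nonneg (hx i) m
    rw [tmul]
    linarith [mul_nonpos_of_nonpos_of_nonneg ht hdiag]

end
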